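/- Let R₁ and R₂ be two reward functions on the same environment that agree on non-terminal transitions, each satisfying the mastery hypotheses with the same rMIN, rMAX, D and r̄MIN, and additionally suppose all non-terminal rewards are non-positive: R₁(s, a, T(s, a)) ≤ 0 whenever s ∉ Abs and T(s, a) ∉ Abs. Then for every s ∉ Abs, the optimal value of task 2 satisfies V*₂(s) = sup over {g ∈ G : g reachable from s} of [V̄*₁(s, g) + Rterm₂(g) − V̄*₁(g, g)], where Rterm₂(g) is the supremum over {a ∈ A : T(g, a) ∈ Abs} of R₂(g, a, T(g, a)). In other words, the optimal value of any new task is obtained zero-shot from an arbitrary world value function together with the new task's terminal rewards. -/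

import Mathlib

open Classical

/-- The state reached after `i` steps when starting in `s` and executing the actions in `as`
(deterministic transition function `T`). `stateAt T s as 0 = s` and
`stateAt T s as (i+1) = T (stateAt T s as i) (as[i])`. -/
def stateAt {S A : Type*} (T : S → A → S) (s : S) (as : List A) (i : ℕ) : S :=
  (as.take i).foldl T s

/-- `as` is a terminating trajectory from `s`: it is nonempty, the final induced state is
absorbing, and no earlier induced state is absorbing. -/
def Terminating {S A : Type*} (T : S → A → S) (Abs : Set S) (s : S) (as : List A) : Prop :=
  as ≠ [] ∧ stateAt T s as as.length ∈ Abs ∧ ∀ i < as.length, stateAt T s as i ∉ Abs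

/-- The achieved goal of a trajectory: the state from which the terminal transition is taken. -/
def achievedGoal {S A : Type*} (T : S → A → S) (s : S) (as : List A) : S :=
  stateAt T s as (as.length - 1)

/-- The return of a trajectory under reward function `R`: the sum of the one-step rewards. -/
def ret {S A : Type*} (T : S → A → S) (R : S → A → S → ℝ) : S → List A → ℝ
  | _, [] => 0
  | s, a :: as => R s a (T s a) + ret T R (T s a) as

/-- The internal goal set: all states from which some action leads to an absorbing state. -/
def goalSet {S A : Type*} (T : S → A → S) (Abs : Set S) : Set S :=
  {s | ∃ a : A, T s a ∈ Abs}

/-- The goal-oriented reward: a penalty `rbMIN` for terminal transitions taken from a state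
other than the goal `g`, and the task reward `R` otherwise. -/
noncomputable def Rbar {S A : Type*} (Abs : Set S) (rbMIN : ℝ) (R : S → A → S → ℝ) (g : S) :
    S → A → S → ℝ :=
  fun s a s' => if s ≠ g ∧ s' ∈ Abs then rbMIN else R s a s'

/-- The optimal value `Q*(s, a)`: the supremum of returns under `R` over terminating
trajectories from `s` whose first action is `a`. -/
noncomputable def Qstar {S A : Type*} (T : S → A → S) (Abs : Set S) (R : S → A → S → ℝ)
    (s : S) (a : A) : ℝ :=
  sSup {x | ∃ as : List A, Terminating T Abs s as ∧ as.head? = some a ∧ ret T R s as = x}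

/-- The optimal state value `V*(s) = sup_a Q*(s, a)`. -/
noncomputable def Vstar {S A : Type*} (T : S → A → S) (Abs : Set S) (R : S → A → S → ℝ)
    (s : S) : ℝ :=
  sSup (Set.range (Qstar T Abs R s))

/-- The optimal world value `Q̄*(s, g, a)`: the optimal value for the goal-oriented reward. -/
noncomputable def Qbar {S A : Type*} (T : S → A → S) (Abs : Set S) (rbMIN : ℝ)
    (R : S → A → S → ℝ) (s g : S) (a : A) : ℝ :=
  Qstar T Abs (Rbar Abs rbMIN R g) s a

/-- The optimal world state value `V̄*(s, g) = sup_a Q̄*(s, g, a)`. -/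
noncomputable def Vbar {S A : Type*} (T : S → A → S) (Abs : Set S) (rbMIN : ℝ)
    (R : S → A → S → ℝ) (s g : S) : ℝ :=
  sSup (Set.range (Qbar T Abs rbMIN R s g))

/-- The environment is proper with horizon `D`: from every non-absorbing state some
terminating trajectory exists, and every terminating trajectory has length at most `D`. -/
def Proper {S A : Type*} (T : S → A → S) (Abs : Set S) (D : ℕ) : Prop :=
  1 ≤ D ∧ (∀ s ∉ Abs, ∃ as : List A, Terminating T Abs s as) ∧
    ∀ (s : S) (as : List A), Terminating T Abs s as → as.length ≤ D

/-- `g` is reachable from `s`: some terminating trajectory from `s` has achieved goal `g`. -/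
def Reachable {S A : Type*} (T : S → A → S) (Abs : Set S) (s g : S) : Prop :=
  ∃ as : List A, Terminating T Abs s as ∧ achievedGoal T s as = g

/-- The optimal terminal reward at a goal state `g`: the supremum of `R(g, a, T(g, a))`
over actions `a` whose transition from `g` is terminal. -/
noncomputable def Rterm {S A : Type*} (T : S → A → S) (Abs : Set S) (R : S → A → S → ℝ)
    (g : S) : ℝ :=
  sSup {x | ∃ a : A, T g a ∈ Abs ∧ R g a (T g a) = x}
/-- Non-absorbing path: all induced states (including the last one) are non-absorbing. -/
def NPath {S A : Type*} (T : S → A → S) (Abs : Set S) : S → List A → Prop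
  | s, [] => s ∉ Abs
  | s, a :: as => s ∉ Abs ∧ NPath T Abs (T s a) as

theorem npath_iff {S A : Type*} (T : S → A → S) (Abs : Set S) (p : List A) :
    ∀ s, NPath T Abs s p ↔ ∀ i ≤ p.length, stateAt T s p i ∉ Abs := by
  induction p with
  | nil => intro s; simp [NPath, stateAt]
  | cons a p ih =>
    intro s
    simp only [NPath, ih, stateAt]
    constructor
    · rintro ⟨h0, h⟩ i hi
      cases i with
      | zero => simpa using h0
      | succ i => simpa using h i (by simpa using hi)
    · intro h
      refine ⟨by simpa using h 0 (by simp), fun i hi => ?_⟩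
      simpa using h (i + 1) (by simpa using hi)

theorem npath_start {S A : Type*} {T : S → A → S} {Abs : Set S} {p : List A} {s : S}
    (h : NPath T Abs s p) : s ∉ Abs := by
  cases p with
  | nil => exact h
  | cons a p => exact h.1

theorem npath_end {S A : Type*} {T : S → A → S} {Abs : Set S} {p : List A} {s : S}
    (h : NPath T Abs s p) : p.foldl T s ∉ Abs := by
  have := (npath_iff T Abs p s).1 h p.length le_rfl
  simpa [stateAt] using this

theorem term_snoc {S A : Type*} (T : S → A → S) (Abs : Set S) (s : S) (p : List A) (a : A) :
    Terminating T Abs s (p ++ [a]) ↔ NPath T Abs s p ∧ T (p.foldl T s) a ∈ Abs := by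
  rw [npath_iff]
  have key : ∀ i ≤ p.length, stateAt T s (p ++ [a]) i = stateAt T s p i := by
    intro i hi
    simp [stateAt, List.take_append_of_le_length hi]
  have kend : stateAt T s (p ++ [a]) (p ++ [a]).length = T (p.foldl T s) a := by
    unfold stateAt
    rw [List.take_length]
    simp
  unfold Terminating
  rw [kend]
  constructor
  · rintro ⟨-, h1, h2⟩
    refine ⟨fun i hi => ?_, h1⟩
    rw [← key i hi]
    exact h2 i (by simp; omega)
  · rintro ⟨h1, h2⟩
    refine ⟨by simp, h2, fun i hi => ?_⟩
    have hi' : i ≤ p.length := by simp at hi; omega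
    rw [key i hi']
    exact h1 i hi'

theorem goal_snoc {S A : Type*} (T : S → A → S) (s : S) (p : List A) (a : A) :
    achievedGoal T s (p ++ [a]) = p.foldl T s := by
  simp [achievedGoal, stateAt]

theorem ret_snoc {S A : Type*} (T : S → A → S) (R : S → A → S → ℝ) (p : List A) (a : A) :
    ∀ s, ret T R s (p ++ [a]) = ret T R s p + R (p.foldl T s) a (T (p.foldl T s) a) := by
  induction p with
  | nil => intro s; simp [ret]
  | cons b p ih => intro s; simp [ret, ih, add_assoc]

theorem ret_congr {S A : Type*} (T : S → A → S) (Abs : Set S) (R R' : S → A → S → ℝ)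
    (h : ∀ s a, T s a ∉ Abs → R s a (T s a) = R' s a (T s a)) (p : List A) :
    ∀ s, NPath T Abs s p → ret T R s p = ret T R' s p := by
  induction p with
  | nil => intro s _; rfl
  | cons b p ih =>
    intro s hp
    simp only [ret]
    rw [ih _ hp.2, h _ _ (npath_start hp.2)]

theorem ret_le {S A : Type*} (T : S → A → S) (Abs : Set S) (R : S → A → S → ℝ) (M : ℝ)
    (h : ∀ s ∉ Abs, ∀ a, T s a ∉ Abs → R s a (T s a) ≤ M) (p : List A) :
    ∀ s, NPath T Abs s p → ret T R s p ≤ M * p.length := by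
  induction p with
  | nil => intro s _; simp [ret]
  | cons b p ih =>
    intro s hp
    have h1 := ih _ hp.2
    have h2 := h s hp.1 b (npath_start hp.2)
    simp only [ret, List.length_cons]
    push_cast
    linarith

theorem le_ret {S A : Type*} (T : S → A → S) (Abs : Set S) (R : S → A → S → ℝ) (m : ℝ)
    (h : ∀ s ∉ Abs, ∀ a, m ≤ R s a (T s a)) (p : List A) :
    ∀ s, NPath T Abs s p → m * p.length ≤ ret T R s p := by
  induction p with
  | nil => intro s _; simp [ret]
  | cons b p ih =>
    intro s hp
    have h1 := ih _ hp.2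
    have h2 := h s hp.1 b
    simp only [ret, List.length_cons]
    push_cast
    linarith

/-- `Vstar` as a least upper bound over decomposed trajectories. -/
theorem vstar_lub {S A : Type*} (T : S → A → S) (Abs : Set S) (R : S → A → S → ℝ) (M : ℝ)
    (D : ℕ) (hP : Proper T Abs D) (hneg : ∀ s ∉ Abs, ∀ a, T s a ∉ Abs → R s a (T s a) ≤ 0)
    (hM : ∀ s ∉ Abs, ∀ a, R s a (T s a) ≤ M) (s : S) (hs : s ∉ Abs) :
    (∀ p a, NPath T Abs s p → T (p.foldl T s) a ∈ Abs →
      ret T R s p + R (p.foldl T s) a (T (p.foldl T s) a) ≤ Vstar T Abs R s) ∧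
    (∀ c, (∀ p a, NPath T Abs s p → T (p.foldl T s) a ∈ Abs →
      ret T R s p + R (p.foldl T s) a (T (p.foldl T s) a) ≤ c) → Vstar T Abs R s ≤ c) := by
  have hne : ∀ a, {x | ∃ as : List A, Terminating T Abs s as ∧ as.head? = some a ∧
      ret T R s as = x}.Nonempty := by
    intro a
    by_cases h : T s a ∈ Abs
    · exact ⟨_, [a], (term_snoc T Abs s [] a).2 ⟨hs, h⟩, rfl, rfl⟩
    · obtain ⟨as, has⟩ := hP.2.1 _ h
      rcases List.eq_nil_or_concat as with rfl | ⟨p, b, rfl⟩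
      · exact absurd rfl has.1
      · rw [List.concat_eq_append] at has
        rw [term_snoc] at has
        exact ⟨_, (a :: p) ++ [b], (term_snoc T Abs s (a :: p) b).2 ⟨⟨hs, has.1⟩, has.2⟩,
          rfl, rfl⟩
  have hQ : ∀ c, (∀ p a, NPath T Abs s p → T (p.foldl T s) a ∈ Abs →
      ret T R s p + R (p.foldl T s) a (T (p.foldl T s) a) ≤ c) → ∀ a,
      ∀ x ∈ {x | ∃ as : List A, Terminating T Abs s as ∧ as.head? = some a ∧
      ret T R s as = x}, x ≤ c := by
    rintro c hc a x ⟨as, has, -, rfl⟩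
    rcases List.eq_nil_or_concat as with rfl | ⟨p, b, rfl⟩
    · exact absurd rfl has.1
    · rw [List.concat_eq_append] at has ⊢
      rw [term_snoc] at has
      rw [ret_snoc]
      exact hc p b has.1 has.2
  have hcM : ∀ p a, NPath T Abs s p → T (p.foldl T s) a ∈ Abs →
      ret T R s p + R (p.foldl T s) a (T (p.foldl T s) a) ≤ M := by
    intro p a hp _
    have h1 := ret_le T Abs R 0 hneg p s hp
    have h2 := hM _ (npath_end hp) a
    linarith
  obtain ⟨as0, has0⟩ := hP.2.1 s hs
  have hA : Nonempty A := by
    cases as0 with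
    | nil => exact absurd rfl has0.1
    | cons a _ => exact ⟨a⟩
  constructor
  · intro p a hp ha
    have hT := (term_snoc T Abs s p a).2 ⟨hp, ha⟩
    obtain ⟨b, hb⟩ : ∃ b, (p ++ [a]).head? = some b := by
      cases p with
      | nil => exact ⟨a, rfl⟩
      | cons b p => exact ⟨b, rfl⟩
    have h1 : ret T R s (p ++ [a]) ≤ Qstar T Abs R s b :=
      le_csSup ⟨M, fun x hx => hQ M hcM b x hx⟩ ⟨_, hT, hb, rfl⟩
    have h2 : Qstar T Abs R s b ≤ Vstar T Abs R s := by
      refine le_csSup ⟨M, ?_⟩ ⟨b, rfl⟩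
      rintro _ ⟨b', rfl⟩
      exact csSup_le (hne b') (hQ M hcM b')
    rw [ret_snoc] at h1
    exact h1.trans h2
  · intro c hc
    refine csSup_le (Set.range_nonempty _) ?_
    rintro _ ⟨b', rfl⟩
    exact csSup_le (hne b') (hQ c hc b')

/-- **Theorem 4(ii)**: zero-shot transfer. If `R₁` and `R₂` agree on non-terminal transitions,
both satisfy the mastery hypotheses, and non-terminal rewards are non-positive, then for every
`s ∉ Abs`, the optimal value of task 2 is
`V*₂(s) = sup_{g ∈ G reachable from s} [V̄*₁(s, g) + Rterm₂(g) − V̄*₁(g, g)]`. -/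
theorem zero_shot_transfer {S A : Type*} (T : S → A → S) (Abs : Set S)
    (R₁ R₂ : S → A → S → ℝ) (rMIN rMAX rbMIN : ℝ) (D : ℕ)
    (hProper : Proper T Abs D)
    (hagree : ∀ (s : S) (a : A), T s a ∉ Abs → R₁ s a (T s a) = R₂ s a (T s a))
    (hbound₁ : ∀ s ∉ Abs, ∀ a : A, rMIN ≤ R₁ s a (T s a) ∧ R₁ s a (T s a) < rMAX)
    (hbound₂ : ∀ s ∉ Abs, ∀ a : A, rMIN ≤ R₂ s a (T s a) ∧ R₂ s a (T s a) < rMAX)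
    (hrMIN : rMIN ≤ 0) (hrMAX : 0 < rMAX)
    (hrb : rbMIN = (rMIN - rMAX) * D)
    (hnonpos : ∀ s ∉ Abs, ∀ a : A, T s a ∉ Abs → R₁ s a (T s a) ≤ 0) :
    ∀ s ∉ Abs,
      Vstar T Abs R₂ s =
        sSup {x | ∃ g ∈ goalSet T Abs, Reachable T Abs s g ∧
          Vbar T Abs rbMIN R₁ s g + Rterm T Abs R₂ g -
            Vbar T Abs rbMIN R₁ g g = x} := by
  intro s hs
  have hD1 : (1 : ℝ) ≤ D := by exact_mod_cast hProper.1
  have hrb_le : rbMIN ≤ rMIN * D := by rw [hrb]; nlinarith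
  have hrb_le' : rbMIN ≤ rMIN := by nlinarith
  have hneg2 : ∀ s ∉ Abs, ∀ a, T s a ∉ Abs → R₂ s a (T s a) ≤ 0 := fun s h a h' => by
    rw [← hagree s a h']; exact hnonpos s h a h'
  have hbarN : ∀ g s a, T s a ∉ Abs →
      Rbar Abs rbMIN R₁ g s a (T s a) = R₁ s a (T s a) := by
    intro g s a h; simp [Rbar, h]
  have hbarG : ∀ g a s', Rbar Abs rbMIN R₁ g g a s' = R₁ g a s' := by
    intro g a s'; simp [Rbar]
  have hbarO : ∀ g h a s', h ≠ g → s' ∈ Abs → Rbar Abs rbMIN R₁ g h a s' = rbMIN := by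
    intro g h a s' h1 h2; simp [Rbar, h1, h2]
  obtain ⟨V2a, V2b⟩ := vstar_lub T Abs R₂ rMAX D hProper hneg2
    (fun s h a => (hbound₂ s h a).2.le) s hs
  have hVb := fun g s hs => vstar_lub T Abs (Rbar Abs rbMIN R₁ g) rMAX D hProper
    (fun s h a h' => by rw [hbarN g s a h']; exact hnonpos s h a h')
    (fun s h a => by
      unfold Rbar
      split_ifs
      · linarith
      · exact (hbound₁ s h a).2.le) s hs
  have hVeq : ∀ g s, Vstar T Abs (Rbar Abs rbMIN R₁ g) s = Vbar T Abs rbMIN R₁ s g :=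
    fun g s => rfl
  simp only [hVeq] at hVb
  have hretb : ∀ g s p, NPath T Abs s p → ret T (Rbar Abs rbMIN R₁ g) s p = ret T R₁ s p :=
    fun g s p hp => ret_congr T Abs _ _ (hbarN g) p s hp
  have hret2 : ∀ s p, NPath T Abs s p → ret T R₁ s p = ret T R₂ s p :=
    fun s p hp => ret_congr T Abs _ _ hagree p s hp
  have hretneg : ∀ s p, NPath T Abs s p → ret T R₁ s p ≤ 0 := fun s p hp => by
    simpa using ret_le T Abs R₁ 0 hnonpos p s hp
  have ht : ∀ R : S → A → S → ℝ, (∀ s ∉ Abs, ∀ a : A, rMIN ≤ R s a (T s a) ∧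
      R s a (T s a) < rMAX) → ∀ g ∉ Abs, ∀ a, T g a ∈ Abs →
      R g a (T g a) ≤ Rterm T Abs R g := by
    intro R hR g hg a ha
    refine le_csSup ⟨rMAX, ?_⟩ ⟨a, ha, rfl⟩
    rintro _ ⟨b, _, rfl⟩
    exact (hR g hg b).2.le
  have ht' : ∀ (R : S → A → S → ℝ) (g : S) (c : ℝ), g ∈ goalSet T Abs →
      (∀ a, T g a ∈ Abs → R g a (T g a) ≤ c) → Rterm T Abs R g ≤ c := by
    rintro R g c ⟨a, ha⟩ h
    refine csSup_le ⟨_, a, ha, rfl⟩ ?_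
    rintro _ ⟨b, hb, rfl⟩
    exact h b hb
  have hgg : ∀ g ∉ Abs, g ∈ goalSet T Abs → Vbar T Abs rbMIN R₁ g g = Rterm T Abs R₁ g := by
    intro g hg hgG
    apply le_antisymm
    · apply (hVb g g hg).2
      intro p a hp ha
      rw [hretb g g p hp]
      have h0 := hretneg g p hp
      by_cases h : p.foldl T g = g
      · rw [h] at ha ⊢
        rw [hbarG]
        have := ht R₁ hbound₁ g hg a ha
        linarith
      · rw [hbarO _ _ _ _ h ha]
        obtain ⟨b, hb⟩ := hgG
        have := ht R₁ hbound₁ g hg b hb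
        have := (hbound₁ g hg b).1
        linarith
    · apply ht' R₁ g _ hgG
      intro a ha
      have := (hVb g g hg).1 [] a hg ha
      simpa [ret, hbarG] using this
  have low : ∀ p, NPath T Abs s p → p.foldl T s ∈ goalSet T Abs →
      ret T R₁ s p + Rterm T Abs R₁ (p.foldl T s) ≤ Vbar T Abs rbMIN R₁ s (p.foldl T s) := by
    intro p hp hG
    have : Rterm T Abs R₁ (p.foldl T s) ≤
        Vbar T Abs rbMIN R₁ s (p.foldl T s) - ret T R₁ s p := by
      apply ht' _ _ _ hG
      intro a ha
      have := (hVb (p.foldl T s) s hs).1 p a hp ha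
      rw [hretb _ s p hp, hbarG] at this
      linarith
    linarith
  have low2 : ∀ p, NPath T Abs s p → p.foldl T s ∈ goalSet T Abs →
      ret T R₁ s p + Rterm T Abs R₂ (p.foldl T s) ≤ Vstar T Abs R₂ s := by
    intro p hp hG
    have : Rterm T Abs R₂ (p.foldl T s) ≤ Vstar T Abs R₂ s - ret T R₁ s p := by
      apply ht' _ _ _ hG
      intro a ha
      have := V2a p a hp ha
      rw [← hret2 s p hp] at this
      linarith
    linarith
  have hub : ∀ x ∈ {x | ∃ g ∈ goalSet T Abs, Reachable T Abs s g ∧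
          Vbar T Abs rbMIN R₁ s g + Rterm T Abs R₂ g -
            Vbar T Abs rbMIN R₁ g g = x}, x ≤ Vstar T Abs R₂ s := by
    rintro _ ⟨g, hG, ⟨as, has, hgoal⟩, rfl⟩
    rcases List.eq_nil_or_concat as with rfl | ⟨p, b, rfl⟩
    · exact absurd rfl has.1
    rw [List.concat_eq_append] at has hgoal
    have hlen := hProper.2.2 _ _ has
    rw [term_snoc] at has
    rw [goal_snoc] at hgoal
    obtain ⟨hp, hb⟩ := has
    have hg : g ∉ Abs := hgoal ▸ npath_end hp
    have hmain : Vbar T Abs rbMIN R₁ s g ≤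
        Vstar T Abs R₂ s - Rterm T Abs R₂ g + Rterm T Abs R₁ g := by
      apply (hVb g s hs).2
      intro q a hq ha
      rw [hretb g s q hq]
      by_cases h : q.foldl T s = g
      · have h1 := low2 q hq (h ▸ hG)
        rw [h] at ha h1 ⊢
        rw [hbarG]
        have := ht R₁ hbound₁ g hg a ha
        linarith
      · rw [hbarO _ _ _ _ h ha]
        have h0 := hretneg s q hq
        have h1 := low2 p hp (hgoal ▸ hG)
        have h2 := le_ret T Abs R₁ rMIN (fun s h a => (hbound₁ s h a).1) p s hp
        rw [hgoal] at h1 hb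
        have h3 := ht R₁ hbound₁ g hg b hb
        have h4 := (hbound₁ g hg b).1
        have h5 : (p.length : ℝ) + 1 ≤ D := by
          have : p.length + 1 ≤ D := by simpa using hlen
          exact_mod_cast this
        have h6 : rMIN * D ≤ rMIN * (p.length + 1) := mul_le_mul_of_nonpos_left h5 hrMIN
        linarith
    rw [hgg g hg hG]
    linarith
  have hmem : ∀ p a, NPath T Abs s p → T (p.foldl T s) a ∈ Abs →
      Vbar T Abs rbMIN R₁ s (p.foldl T s) + Rterm T Abs R₂ (p.foldl T s) -
            Vbar T Abs rbMIN R₁ (p.foldl T s) (p.foldl T s) ∈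
        {x | ∃ g ∈ goalSet T Abs, Reachable T Abs s g ∧
          Vbar T Abs rbMIN R₁ s g + Rterm T Abs R₂ g -
            Vbar T Abs rbMIN R₁ g g = x} := fun p a hp ha =>
    ⟨_, ⟨a, ha⟩, ⟨p ++ [a], (term_snoc T Abs s p a).2 ⟨hp, ha⟩, goal_snoc T s p a⟩, rfl⟩
  apply le_antisymm
  · apply V2b
    intro p a hp ha
    refine le_trans ?_ (le_csSup ⟨_, hub⟩ (hmem p a hp ha))
    have hg := npath_end hp
    rw [hgg _ hg ⟨a, ha⟩, ← hret2 s p hp]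
    have h1 := low p hp ⟨a, ha⟩
    have h2 := ht R₂ hbound₂ _ hg a ha
    linarith
  · obtain ⟨as, has⟩ := hProper.2.1 s hs
    rcases List.eq_nil_or_concat as with rfl | ⟨p, b, rfl⟩
    · exact absurd rfl has.1
    rw [List.concat_eq_append, term_snoc] at has
    exact csSup_le ⟨_, hmem p b has.1 has.2⟩ hub
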